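/- arXiv:1803.04020 — 8 statements merged into one kernel-verified Lean document; each statement's English description precedes it below -/
import Mathlib

section
/- For every prime power q and every integer k ≥ 2, there exists an [n,k]_q maximum weight spectrum code with length n = 2^{θ_q(k−1)} − 1, where θ_q(k−1) = (q^k − 1)/(q − 1). -/
/-- The Hamming weight of a vector: the number of nonzero coordinates. -/
def wt {ι F : Type*} [Fintype ι] [Zero F] [DecidableEq F] (c : ι → F) : ℕ :=
  (Finset.univ.filter fun i => c i ≠ 0).card

/-- The weight set of a code: the set of nonzero weights of nonzero codewords. -/
def wtSet {ι F : Type*} [Fintype ι] [Zero F] [DecidableEq F] (C : Set (ι → F)) : Set ℕ :=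
  {w | ∃ c ∈ C, c ≠ 0 ∧ wt c = w}

open scoped LinearAlgebra.Projectivization

theorem wt_smul {ι F : Type*} [Fintype ι] [Field F] [DecidableEq F] {a : F} (ha : a ≠ 0)
    (c : ι → F) : wt (a • c) = wt c := by
  simp [wt, ha]

theorem wt_comp_equiv {ι κ F : Type*} [Fintype ι] [Fintype κ] [Zero F] [DecidableEq F]
    (e : ι ≃ κ) (c : κ → F) : wt (c ∘ e) = wt c :=
  Finset.card_equiv e (by simp)

theorem wt_sigma_fst {ι F : Type*} {α : ι → Type*} [Fintype ι] [∀ i, Fintype (α i)] [Zero F]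
    [DecidableEq F] (c : ι → F) :
    wt (fun x : Σ i, α i ↦ c x.1) = ∑ i with c i ≠ 0, Fintype.card (α i) := by
  have : (Finset.univ.filter fun x : Σ i, α i ↦ c x.1 ≠ 0) =
      (Finset.univ.filter fun i ↦ c i ≠ 0).sigma fun _ ↦ Finset.univ := by
    ext; simp
  rw [wt, this, Finset.card_sigma]
  rfl

theorem Fin.sum_two_pow_injective (m : ℕ) :
    Function.Injective fun s : Finset (Fin m) ↦ ∑ i ∈ s, 2 ^ (i : ℕ) := by
  intro s t h
  apply Finset.map_injective Fin.valEmbedding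
  apply Finset.geomSum_injective le_rfl
  simpa using h

theorem Projectivization.ker_le_ker_of_forall_rep {F W : Type*} [Field F] [AddCommGroup W] [Module F W]
    {f g : Module.Dual F W} (h : ∀ x : ℙ F W, f x.rep = 0 → g x.rep = 0) :
    LinearMap.ker f ≤ LinearMap.ker g := by
  intro v hv
  rw [LinearMap.mem_ker] at hv ⊢
  by_cases hv0 : v = 0
  · simp [hv0]
  obtain ⟨a, ha⟩ := Projectivization.exists_smul_eq_mk_rep F v hv0
  have := h (Projectivization.mk F v hv0)
  rw [← ha, Units.smul_def, map_smul, map_smul, hv] at this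
  simpa using this

theorem Projectivization.mk_eq_mk_of_ker_le {F W : Type*} [Field F] [AddCommGroup W]
    [Module F W] {f g : Module.Dual F W} (hf : f ≠ 0) (hg : g ≠ 0)
    (h : LinearMap.ker f ≤ LinearMap.ker g) :
    Projectivization.mk F f hf = Projectivization.mk F g hg := by
  have hmem : g ∈ Submodule.span F (Set.range fun _ : Unit ↦ f) :=
    mem_span_of_iInf_ker_le_ker (by simpa using h)
  rw [Set.range_const, Submodule.mem_span_singleton] at hmem
  exact ((Projectivization.mk_eq_mk_iff' F g f hg hf).2 hmem).symm

/-- The linear map sending a functional to its values on a family of points of a projective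
space. -/
noncomputable def evalPoints {ι F W : Type*} [Field F] [AddCommGroup W] [Module F W]
    (p : ι → ℙ F W) : Module.Dual F W →ₗ[F] (ι → F) :=
  LinearMap.pi fun i ↦ LinearMap.applyₗ (p i).rep

theorem evalPoints_injective {ι F W : Type*} [Field F] [AddCommGroup W] [Module F W]
    {p : ι → ℙ F W} (hp : Function.Surjective p) : Function.Injective (evalPoints p) := by
  rw [injective_iff_map_eq_zero]
  intro f hf
  have h : LinearMap.ker (0 : Module.Dual F W) ≤ LinearMap.ker f := by
    apply Projectivization.ker_le_ker_of_forall_rep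
    intro x _
    obtain ⟨i, rfl⟩ := hp x
    exact congrFun hf i
  rw [LinearMap.ker_zero, top_le_iff] at h
  exact LinearMap.ker_eq_top.1 h

/-- If the weight of the evaluation of a functional determines the points at which it vanishes,
then the weights are in bijection with the hyperplanes. -/
theorem ncard_wtSet_range_evalPoints {ι F W : Type*} [Fintype ι] [Field F] [DecidableEq F]
    [AddCommGroup W] [Module F W] {p : ι → ℙ F W} (hp : Function.Surjective p)
    (hw : ∀ f g : Module.Dual F W, wt (evalPoints p f) = wt (evalPoints p g) →
      ∀ x : ℙ F W, f x.rep = 0 → g x.rep = 0) :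
    (wtSet (LinearMap.range (evalPoints p) : Set (ι → F))).ncard =
      Nat.card (ℙ F (Module.Dual F W)) := by
  have hrange : wtSet (LinearMap.range (evalPoints p) : Set (ι → F)) =
      Set.range fun x : ℙ F (Module.Dual F W) ↦ wt (evalPoints p x.rep) := by
    ext w
    constructor
    · rintro ⟨_, ⟨f, rfl⟩, hf, rfl⟩
      have hf0 : f ≠ 0 := fun h ↦ hf (by rw [h, map_zero])
      obtain ⟨a, ha⟩ := Projectivization.exists_smul_eq_mk_rep F f hf0
      refine ⟨Projectivization.mk F f hf0, ?_⟩
      simp only [← ha, Units.smul_def, map_smul]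
      exact wt_smul a.ne_zero _
    · rintro ⟨x, rfl⟩
      exact ⟨_, ⟨x.rep, rfl⟩,
        (map_ne_zero_iff _ (evalPoints_injective hp)).2 x.rep_nonzero, rfl⟩
  have hinj : Function.Injective
      fun x : ℙ F (Module.Dual F W) ↦ wt (evalPoints p x.rep) := by
    intro x y hxy
    rw [← x.mk_rep, ← y.mk_rep]
    exact Projectivization.mk_eq_mk_of_ker_le _ _
      (Projectivization.ker_le_ker_of_forall_rep (hw _ _ hxy))
  rw [hrange, ← Set.image_univ, Set.ncard_image_of_injective _ hinj, Set.ncard_univ]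

/-- For every prime power `q` and every integer `k ≥ 2`, there exists an `[n,k]_q`
maximum weight spectrum code of length `n = 2^(θ_q(k-1)) - 1`,
where `θ_q(k-1) = (q^k - 1)/(q - 1)`. -/
theorem exists_MWS_long (q k : ℕ) (hq : IsPrimePow q) (hk : 2 ≤ k)
    (F : Type*) [Field F] [Fintype F] [DecidableEq F] (hcard : Fintype.card F = q) :
    ∃ C : Submodule F (Fin (2 ^ ((q ^ k - 1) / (q - 1)) - 1) → F),
      Module.finrank F C = k ∧
      (wtSet (C : Set (Fin (2 ^ ((q ^ k - 1) / (q - 1)) - 1) → F))).ncard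
        = (q ^ k - 1) / (q - 1) := by
  have hW : Nat.card (ℙ F (Fin k → F)) = (q ^ k - 1) / (q - 1) := by
    simp [Projectivization.card'', Nat.card_eq_fintype_card, hcard]
  have hdual : Nat.card (ℙ F (Module.Dual F (Fin k → F))) = (q ^ k - 1) / (q - 1) := by
    rw [← hW, Projectivization.card_of_finrank F _ Subspace.dual_finrank_eq,
      Projectivization.card_of_finrank F _ rfl]
  generalize (q ^ k - 1) / (q - 1) = m at hW hdual ⊢
  let e : ℙ F (Fin k → F) ≃ Fin m := Finite.equivFinOfCardEq hW
  have hsum : ∑ i : Fin m, 2 ^ (i : ℕ) = 2 ^ m - 1 := by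
    rw [Fin.sum_univ_eq_sum_range, Nat.geomSum_eq le_rfl]
    simp
  let σ : Fin (2 ^ m - 1) ≃ Σ i : Fin m, Fin (2 ^ (i : ℕ)) :=
    (finCongr hsum.symm).trans finSigmaFinEquiv.symm
  let p : Fin (2 ^ m - 1) → ℙ F (Fin k → F) := fun j ↦ e.symm (σ j).1
  have hp : Function.Surjective p := fun x ↦ ⟨σ.symm ⟨e x, ⟨0, by positivity⟩⟩, by simp [p]⟩
  have hwt (f : Module.Dual F (Fin k → F)) :
      wt (evalPoints p f) = ∑ i : Fin m with f (e.symm i).rep ≠ 0, 2 ^ (i : ℕ) := by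
    have := wt_sigma_fst (α := fun i : Fin m ↦ Fin (2 ^ (i : ℕ))) fun i ↦ f (e.symm i).rep
    simp only [Fintype.card_fin] at this
    rw [← this, ← wt_comp_equiv σ]
    rfl
  refine ⟨LinearMap.range (evalPoints p), ?_, ?_⟩
  · rw [LinearMap.finrank_range_of_inj (evalPoints_injective hp), Subspace.dual_finrank_eq,
      Module.finrank_fin_fun]
  · rw [ncard_wtSet_range_evalPoints hp, hdual]
    intro f g hfg x
    rw [hwt, hwt] at hfg
    have := Finset.ext_iff.1 (Fin.sum_two_pow_injective m hfg) (e x)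
    simp only [Finset.mem_filter_univ, Equiv.symm_apply_apply, ne_eq, not_iff_not] at this
    exact this.1
end

section
/- If C is an [n,k]_q maximum weight spectrum code with k ≥ 2, then n ≥ ⌈q·θ_q(k−1)/2⌉ = ⌈(q^{k+1} − q)/(2(q − 1))⌉. -/
/-- Distinct natural numbers sum to at least `0 + 1 + ⋯ + (m - 1)`. -/
theorem card_mul_card_sub_one_le_two_mul_sum (T : Finset ℕ) :
    T.card * (T.card - 1) ≤ 2 * ∑ t ∈ T, t := by
  rw [← Finset.sum_range_id_mul_two, mul_comm 2]
  refine Nat.mul_le_mul_right 2 ?_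
  have h := Finset.sum_range_le_sum (s := T.map Nat.castEmbedding) (c := (0 : ℤ)) (by simp)
  simp only [Finset.card_map, zero_add, Finset.sum_map, Nat.castEmbedding_apply] at h
  zify
  exact h

section Code

variable {ι F : Type*} [Fintype ι] [Field F] [DecidableEq F]

open Classical in
/-- The coordinates on which a code does not vanish identically. -/
noncomputable def activeCoords (C : Submodule F (ι → F)) : Finset ι :=
  Finset.univ.filter fun i => ∃ c ∈ C, c i ≠ 0

/-- The number of active coordinates at which a codeword vanishes. -/
noncomputable def activeZeros (C : Submodule F (ι → F)) (c : ι → F) : ℕ :=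
  ((activeCoords C).filter fun i => c i = 0).card

theorem activeZeros_add_wt (C : Submodule F (ι → F)) {c : ι → F} (hc : c ∈ C) :
    activeZeros C c + wt c = (activeCoords C).card := by
  rw [← Finset.card_filter_add_card_filter_not (s := activeCoords C) (fun i => c i = 0)]
  unfold activeZeros wt
  congr 2
  ext i
  simp only [activeCoords, Finset.mem_filter, Finset.mem_univ, true_and]
  exact ⟨fun h => ⟨⟨c, hc, h⟩, h⟩, fun h => h.2⟩

theorem activeZeros_smul (C : Submodule F (ι → F)) (u : Fˣ) (c : ι → F) :
    activeZeros C (u • c) = activeZeros C c := by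
  simp [activeZeros, Units.smul_def]

theorem ncard_wtSet_le (C : Submodule F (ι → F)) [Fintype C] [DecidableEq C] :
    (wtSet (C : Set (ι → F))).ncard ≤
      (((Finset.univ : Finset C).erase 0).image fun c : C => activeZeros C c).card := by
  classical
  set T := ((Finset.univ : Finset C).erase 0).image fun c : C => activeZeros C c
  have hsub : wtSet (C : Set (ι → F)) ⊆ (T.image fun t => (activeCoords C).card - t) := by
    rintro w ⟨c, hc, hne, rfl⟩
    refine Finset.mem_coe.mpr (Finset.mem_image.mpr ⟨activeZeros C c, ?_, ?_⟩)
    · exact Finset.mem_image.mpr ⟨⟨c, hc⟩, by simpa using hne, rfl⟩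
    · have := activeZeros_add_wt C hc
      omega
  calc _ ≤ _ := Set.ncard_le_ncard hsub (Finset.finite_toSet _)
    _ = _ := Set.ncard_coe_finset _
    _ ≤ _ := Finset.card_image_le

variable [Fintype F]

theorem card_filter_apply_eq_zero (C : Submodule F (ι → F)) [Fintype C] {i : ι}
    (hi : i ∈ activeCoords C) :
    (Finset.univ.filter fun c : C => (c : ι → F) i = 0).card =
      Fintype.card F ^ (Module.finrank F C - 1) := by
  classical
  let f : C →ₗ[F] F := (LinearMap.proj i).comp C.subtype
  have hf : f ≠ 0 := by
    obtain ⟨c, hc, hci⟩ := (by simpa [activeCoords] using hi : ∃ c ∈ C, c i ≠ 0)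
    exact fun h => hci (LinearMap.congr_fun h ⟨c, hc⟩)
  have hrank := Module.Dual.finrank_ker_add_one_of_ne_zero hf
  have hker : (Finset.univ.filter fun c : C => (c : ι → F) i = 0).card =
      Fintype.card (LinearMap.ker f) := by
    rw [Fintype.card_subtype]
    congr 1
    ext c
    simp [f]
  rw [hker, Module.card_eq_pow_finrank (K := F), ← hrank, Nat.add_sub_cancel]

theorem sum_activeZeros (C : Submodule F (ι → F)) [Fintype C] :
    ∑ c : C, activeZeros C c =
      (activeCoords C).card * Fintype.card F ^ (Module.finrank F C - 1) := by
  simp only [activeZeros, Finset.card_filter]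
  rw [Finset.sum_comm]
  simp only [← Finset.card_filter]
  rw [Finset.sum_congr rfl fun i hi => card_filter_apply_eq_zero C hi]
  simp

theorem card_sub_one_le_card_filter_activeZeros (C : Submodule F (ι → F)) [Fintype C]
    [DecidableEq C] {c : C} (hc : c ≠ 0) :
    Fintype.card F - 1 ≤ (((Finset.univ : Finset C).erase 0).filter
      fun d : C => activeZeros C d = activeZeros C c).card := by
  rw [← Fintype.card_units, ← Finset.card_univ]
  refine Finset.card_le_card_of_injOn (fun u : Fˣ => u • c) ?_ ?_
  · intro u _
    simp only [Finset.coe_filter, Finset.mem_erase, Finset.mem_univ, and_true, Set.mem_ofPred_eq]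
    exact ⟨(smul_ne_zero_iff_ne u).mpr hc, activeZeros_smul C u c⟩
  · intro u _ v _ huv
    exact Units.ext (smul_left_injective F hc
      (by simpa only [Units.smul_def] using huv))

theorem ncard_wtSet_mul_le (C : Submodule F (ι → F)) :
    (Fintype.card F - 1) *
        ((wtSet (C : Set (ι → F))).ncard * ((wtSet (C : Set (ι → F))).ncard - 1)) ≤
      2 * ((activeCoords C).card * (Fintype.card F ^ (Module.finrank F C - 1) - 1)) := by
  classical
  have : Fintype C := Fintype.ofFinite C
  set T := ((Finset.univ : Finset C).erase 0).image fun c : C => activeZeros C c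
  have hN := ncard_wtSet_le C
  have hsum : ∑ c ∈ (Finset.univ : Finset C).erase 0, activeZeros C c =
      (activeCoords C).card * (Fintype.card F ^ (Module.finrank F C - 1) - 1) := by
    have h := Finset.sum_erase_add Finset.univ (fun c : C => activeZeros C c)
      (Finset.mem_univ 0)
    rw [sum_activeZeros] at h
    have h0 : activeZeros C ((0 : C) : ι → F) = (activeCoords C).card := by
      simp [activeZeros]
    rw [Nat.mul_sub_one]
    omega
  have hfib : (Fintype.card F - 1) * ∑ t ∈ T, t ≤
      ∑ c ∈ (Finset.univ : Finset C).erase 0, activeZeros C c := by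
    rw [Finset.sum_comp (fun t => t) (fun c : C => activeZeros C c), Finset.mul_sum]
    refine Finset.sum_le_sum fun t ht => ?_
    obtain ⟨c, hc, rfl⟩ := Finset.mem_image.mp ht
    exact Nat.mul_le_mul_right _
      (card_sub_one_le_card_filter_activeZeros C (Finset.ne_of_mem_erase hc))
  calc _ ≤ (Fintype.card F - 1) * (T.card * (T.card - 1)) := by gcongr
    _ ≤ (Fintype.card F - 1) * (2 * ∑ t ∈ T, t) :=
      Nat.mul_le_mul_left _ (card_mul_card_sub_one_le_two_mul_sum T)
    _ = 2 * ((Fintype.card F - 1) * ∑ t ∈ T, t) := by ring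
    _ ≤ _ := by
      rw [← hsum]
      gcongr

end Code

/-- If `C` is an `[n,k]_q` maximum weight spectrum code with `k ≥ 2`, then
`n ≥ ⌈q·θ_q(k-1)/2⌉ = ⌈(q^(k+1) - q)/(2(q-1))⌉`. -/
theorem MWS_length_lower_bound (q n k : ℕ) (hq : IsPrimePow q) (hk : 2 ≤ k)
    (F : Type*) [Field F] [Fintype F] [DecidableEq F] (hcard : Fintype.card F = q)
    (C : Submodule F (Fin n → F)) (hdim : Module.finrank F C = k)
    (hMWS : (wtSet (C : Set (Fin n → F))).ncard = (q ^ k - 1) / (q - 1)) :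
    (n : ℤ) ≥ ⌈(((q : ℚ) ^ (k + 1) - q) / (2 * ((q : ℚ) - 1)))⌉ := by
  obtain ⟨m, rfl⟩ : ∃ m, k = m + 2 := ⟨k - 2, by omega⟩
  have hq2 : 2 ≤ q := hq.two_le
  have h := ncard_wtSet_mul_le C
  rw [hMWS, hcard, hdim] at h
  set N := (q ^ (m + 2) - 1) / (q - 1) with hN
  have hNq : N * (q - 1) = q ^ (m + 2) - 1 :=
    Nat.div_mul_cancel (by simpa using Nat.sub_dvd_pow_sub_pow q 1 (m + 2))
  have ha : (activeCoords C).card ≤ n := by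
    simpa using Finset.card_le_univ (activeCoords C)
  have hM : 1 < q ^ (m + 1) := Nat.one_lt_pow (by omega) (by omega)
  have hM' : 1 ≤ q ^ (m + 2) := Nat.one_le_pow _ _ (by omega)
  have hN1 : 1 ≤ N := by
    rw [hN, Nat.one_le_div_iff (by omega)]
    exact Nat.sub_le_sub_right (Nat.le_self_pow (by omega) q) 1
  rw [show m + 2 - 1 = m + 1 from rfl] at h
  generalize (activeCoords C).card = a at h ha
  clear_value N
  qify [hM.le, hM', hN1, (by omega : 1 ≤ q)] at h hNq ha hM hq2 hN1
  have hmul : (q : ℚ) * N * ((q : ℚ) ^ (m + 1) - 1) ≤ 2 * a * ((q : ℚ) ^ (m + 1) - 1) := by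
    have : ((q : ℚ) - 1) * (N * (N - 1)) = q * N * ((q : ℚ) ^ (m + 1) - 1) := by
      linear_combination (N : ℚ) * hNq
    linarith
  have hle : (q : ℚ) * N ≤ 2 * a := le_of_mul_le_mul_right hmul (by linarith)
  rw [ge_iff_le, Int.ceil_le, div_le_iff₀ (by linarith)]
  push_cast
  have hval : (q : ℚ) ^ (m + 2 + 1) - q = q * N * (q - 1) := by
    linear_combination -(q : ℚ) * hNq
  rw [hval]
  nlinarith
end

section
/- For every prime power q, there exists an [n,2]_q maximum weight spectrum code with n = q(q+1)/2; consequently the lower bound n ≥ ⌈q·θ_q(1)/2⌉ on the length of MWS codes of dimension 2 is attained for every prime power q. -/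
/-- There is a map from a set of size `q(q+1)/2` to `{0, …, q}` whose fibre over each `j`
has size `j`. -/
theorem exists_map_card_fiber_eq (q : ℕ) :
    ∃ g : Fin (q * (q + 1) / 2) → Fin (q + 1),
      ∀ j, (Finset.univ.filter fun i => g i = j).card = (j : ℕ) := by
  have hcard : Fintype.card (Σ j : Fin (q + 1), Fin j) = q * (q + 1) / 2 := by
    simp only [Fintype.card_sigma, Fintype.card_fin]
    rw [Fin.sum_univ_eq_sum_range (fun i => i), Finset.sum_range_id, Nat.add_sub_cancel, mul_comm]
  let e := Fintype.equivFinOfCardEq hcard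
  refine ⟨fun i => (e.symm i).1, fun j => ?_⟩
  have himage : (Finset.univ.filter fun i => (e.symm i).1 = j) =
      (Finset.univ : Finset (Fin j)).map
        ((Function.Embedding.sigmaMk (β := fun j : Fin (q + 1) => Fin j) j).trans
          e.toEmbedding) := by
    ext i
    simp only [Finset.mem_filter, Finset.mem_univ, true_and, Finset.mem_map]
    constructor
    · rintro rfl
      exact ⟨(e.symm i).2, e.apply_symm_apply i⟩
    · rintro ⟨a, rfl⟩
      simp
  rw [himage, Finset.card_map, Finset.card_univ, Fintype.card_fin]

/-- The linear functional on `F × F` attached to a point of the projective line `Option F`. -/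
def lineFunctional (F : Type*) [Field F] : Option F → F × F →ₗ[F] F
  | none => LinearMap.snd F F F
  | some t => LinearMap.fst F F F + t • LinearMap.snd F F F

/-- A nonzero vector is annihilated by the functional of exactly one point of the projective
line. -/
theorem exists_lineFunctional_eq_zero_iff {F : Type*} [Field F] {v : F × F} (hv : v ≠ 0) :
    ∃ p : Option F, ∀ r, lineFunctional F r v = 0 ↔ r = p := by
  obtain ⟨a, b⟩ := v
  by_cases hb : b = 0
  · subst hb
    have ha : a ≠ 0 := fun h => hv (by simp [h])
    refine ⟨none, fun r => ?_⟩
    cases r <;> simp [lineFunctional, ha]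
  · refine ⟨some (-a / b), fun r => ?_⟩
    cases r with
    | none => simp [lineFunctional, hb]
    | some t =>
      simp only [lineFunctional, LinearMap.add_apply, LinearMap.smul_apply, LinearMap.fst_apply,
        LinearMap.snd_apply, smul_eq_mul, Option.some.injEq]
      rw [eq_div_iff hb, eq_neg_iff_add_eq_zero, add_comm]

/-- Each point of the projective line is the annihilating point of some nonzero vector. -/
theorem exists_ne_zero_lineFunctional_eq_zero {F : Type*} [Field F] (p : Option F) :
    ∃ v : F × F, v ≠ 0 ∧ lineFunctional F p v = 0 := by
  cases p with
  | none => exact ⟨(1, 0), by simp, by simp [lineFunctional]⟩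
  | some t => exact ⟨(-t, 1), by simp, by simp [lineFunctional]⟩

/-- For every prime power `q` there exists an `[n,2]_q` maximum weight spectrum code with
`n = q(q+1)/2`; consequently the lower bound `n ≥ ⌈q·θ_q(1)/2⌉` on the length of MWS
codes of dimension `2` is attained for every prime power `q`. -/
theorem exists_MWS_dim_two_optimal (q : ℕ) (hq : IsPrimePow q)
    (F : Type*) [Field F] [Fintype F] [DecidableEq F] (hcard : Fintype.card F = q) :
    (∃ C : Submodule F (Fin (q * (q + 1) / 2) → F),
      Module.finrank F C = 2 ∧
      (wtSet (C : Set (Fin (q * (q + 1) / 2) → F))).ncard = (q ^ 2 - 1) / (q - 1)) ∧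
    ((q * (q + 1) / 2 : ℤ) = ⌈((q : ℚ) * (((q : ℚ) ^ 2 - 1) / ((q : ℚ) - 1)) / 2)⌉) := by
  have hq2 : 2 ≤ q := hq.two_le
  constructor
  · obtain ⟨g, hg⟩ := exists_map_card_fiber_eq q
    let e : Option F ≃ Fin (q + 1) := Fintype.equivFinOfCardEq (by simp [hcard])
    let φ : F × F →ₗ[F] (Fin (q * (q + 1) / 2) → F) :=
      LinearMap.pi fun i => lineFunctional F (e.symm (g i))
    have hwt : ∀ (v : F × F) (p : Option F), (∀ r, lineFunctional F r v = 0 ↔ r = p) →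
        wt (φ v) + e p = q * (q + 1) / 2 := by
      intro v p hp
      have hsplit := Finset.card_filter_add_card_filter_not
        (s := (Finset.univ : Finset (Fin (q * (q + 1) / 2)))) (fun i => g i = e p)
      rw [hg, Finset.card_univ, Fintype.card_fin, add_comm] at hsplit
      refine Eq.trans ?_ hsplit
      rw [wt]
      simp only [φ, LinearMap.pi_apply, ne_eq, hp, Equiv.symm_apply_eq]
    have hlt : q < q * (q + 1) / 2 := by
      rw [Nat.lt_iff_add_one_le, Nat.le_div_iff_mul_le two_pos]
      nlinarith
    have hne : ∀ v, v ≠ 0 → φ v ≠ 0 := by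
      intro v hv h0
      obtain ⟨p, hp⟩ := exists_lineFunctional_eq_zero_iff hv
      have hp' := hwt v p hp
      have h0' : wt (φ v) = 0 := by simp [h0, wt]
      have := (e p).isLt
      omega
    have hinj : Function.Injective φ :=
      (injective_iff_map_eq_zero φ).2 fun v h => by_contra fun hv => hne v hv h
    refine ⟨LinearMap.range φ, ?_, ?_⟩
    · rw [LinearMap.finrank_range_of_inj hinj]
      simp
    · have hset : wtSet (LinearMap.range φ : Set (Fin (q * (q + 1) / 2) → F)) =
          Set.range fun p => q * (q + 1) / 2 - (e p : ℕ) := by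
        ext w
        constructor
        · rintro ⟨_, ⟨v, rfl⟩, hv, rfl⟩
          have hv0 : v ≠ 0 := fun h => hv (by simp [h])
          obtain ⟨p, hp⟩ := exists_lineFunctional_eq_zero_iff hv0
          exact ⟨p, by have := hwt v p hp; dsimp only; omega⟩
        · rintro ⟨p, rfl⟩
          obtain ⟨v, hv, hpv⟩ := exists_ne_zero_lineFunctional_eq_zero p
          obtain ⟨p', hp'⟩ := exists_lineFunctional_eq_zero_iff hv
          obtain rfl := (hp' p).1 hpv
          exact ⟨φ v, ⟨v, rfl⟩, hne v hv, by have := hwt v p hp'; dsimp only; omega⟩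
      have hinj' : Function.Injective fun p => q * (q + 1) / 2 - (e p : ℕ) := by
        intro p r h
        have hp := (e p).isLt
        have hr := (e r).isLt
        dsimp only at h
        exact e.injective (Fin.ext (by omega))
      rw [hset, ← Set.image_univ, Set.ncard_image_of_injective _ hinj', Set.ncard_univ,
        Nat.card_eq_fintype_card, Fintype.card_option, hcard]
      have hfactor : q ^ 2 - 1 = (q + 1) * (q - 1) := by simpa using Nat.sq_sub_sq q 1
      rw [hfactor, Nat.mul_div_cancel _ (by omega)]
  · obtain ⟨m, hm⟩ := (Int.even_mul_succ_self (q : ℤ)).two_dvd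
    have hq1 : (q : ℚ) - 1 ≠ 0 := by
      have : (2 : ℚ) ≤ q := by exact_mod_cast hq2
      linarith
    have hmQ : (q : ℚ) * (q + 1) = 2 * m := by exact_mod_cast hm
    have hval : (q : ℚ) * (((q : ℚ) ^ 2 - 1) / ((q : ℚ) - 1)) / 2 = (m : ℚ) := by
      have hdiv : ((q : ℚ) ^ 2 - 1) / ((q : ℚ) - 1) = q + 1 := by
        rw [div_eq_iff hq1]
        ring
      rw [hdiv, hmQ]
      ring
    rw [hval, Int.ceil_intCast, hm, Int.mul_ediv_cancel_left _ two_ne_zero]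
end

section
/- There exists a [7,3]_2 maximum weight spectrum code, i.e., a 3-dimensional binary linear code of length 7 whose weight set has cardinality θ_2(2) = 7. -/
/-- The map repeating the three coordinates of a vector `1`, `2` and `4` times. -/
def repeatCoord : Fin 7 → Fin 3 := ![0, 1, 1, 2, 2, 2, 2]

theorem repeatCoord_surjective : Function.Surjective repeatCoord := by decide

theorem wt_comp_repeatCoord_mem_Icc :
    ∀ v : Fin 3 → ZMod 2, v ∘ repeatCoord ≠ 0 → wt (v ∘ repeatCoord) ∈ Finset.Icc 1 7 := by
  decide

theorem exists_wt_comp_repeatCoord_eq :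
    ∀ w ∈ Finset.Icc 1 7, ∃ v : Fin 3 → ZMod 2,
      v ∘ repeatCoord ≠ 0 ∧ wt (v ∘ repeatCoord) = w := by
  decide

/-- There exists a `[7,3]_2` maximum weight spectrum code: a `3`-dimensional binary linear
code of length `7` whose weight set has cardinality `θ_2(2) = 7`. -/
theorem exists_MWS_7_3_2 :
    ∃ C : Submodule (ZMod 2) (Fin 7 → ZMod 2),
      Module.finrank (ZMod 2) C = 3 ∧
      (wtSet (C : Set (Fin 7 → ZMod 2))).ncard = 7 := by
  refine ⟨LinearMap.range (LinearMap.funLeft (ZMod 2) (ZMod 2) repeatCoord), ?_, ?_⟩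
  · rw [LinearMap.finrank_range_of_inj
      (LinearMap.funLeft_injective_of_surjective _ _ _ repeatCoord_surjective)]
    simp
  · have h : wtSet (LinearMap.range (LinearMap.funLeft (ZMod 2) (ZMod 2) repeatCoord) :
        Set (Fin 7 → ZMod 2)) = (Finset.Icc 1 7 : Finset ℕ) := by
      ext w
      constructor
      · rintro ⟨_, ⟨v, rfl⟩, hv, rfl⟩
        exact wt_comp_repeatCoord_mem_Icc v hv
      · intro hw
        obtain ⟨v, hv, hvw⟩ := exists_wt_comp_repeatCoord_eq w hw
        exact ⟨_, ⟨v, rfl⟩, hv, hvw⟩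
    rw [h, Set.ncard_coe_finset]
    simp
end

section
/- There exists a [32,3]_3 maximum weight spectrum code, i.e., a 3-dimensional ternary linear code of length 32 whose weight set has cardinality θ_3(2) = 13. -/
/-- The rows of a generator matrix of a `[32,3]_3` maximum weight spectrum code. -/
def generatorRows : Fin 3 → Fin 32 → ZMod 3 :=
  ![![0, 0, 0, 0, 0, 0, 0, 0, 1, 1, 1, 1, 1, 1, 1, 1, 1, 1, 1, 1, 1, 1, 1, 1, 1, 1, 1, 1, 1, 1, 1, 1],
    ![0, 0, 0, 1, 1, 1, 1, 1, 0, 1, 1, 1, 1, 1, 1, 1, 1, 1, 1, 1, 1, 1, 1, 2, 2, 2, 2, 2, 2, 2, 2, 2],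
    ![1, 1, 1, 0, 0, 1, 1, 2, 1, 1, 1, 1, 1, 1, 1, 1, 1, 1, 1, 1, 2, 2, 2, 0, 0, 0, 0, 1, 1, 1, 1, 1]]

theorem linearIndependent_generatorRows : LinearIndependent (ZMod 3) generatorRows := by
  rw [Fintype.linearIndependent_iff]
  intro g hg
  have h0 : g 2 = 0 := by
    simpa [generatorRows, Fin.sum_univ_three] using congrFun hg 0
  have h3 : g 1 = 0 := by
    simpa [generatorRows, Fin.sum_univ_three] using congrFun hg 3
  have h8 : g 0 + g 2 = 0 := by
    simpa [generatorRows, Fin.sum_univ_three] using congrFun hg 8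
  rw [h0, add_zero] at h8
  intro i
  fin_cases i <;> assumption

theorem image_wt_generatorRows :
    (Finset.univ.filter fun v : Fin 3 → ZMod 3 => v ≠ 0).image
        (fun v => wt (∑ i, v i • generatorRows i)) =
      {13, 15, 16, 19, 20, 22, 23, 24, 25, 26, 27, 28, 30} := by
  decide +kernel

theorem wtSet_span_generatorRows :
    wtSet (Submodule.span (ZMod 3) (Set.range generatorRows) : Set (Fin 32 → ZMod 3)) =
      (({13, 15, 16, 19, 20, 22, 23, 24, 25, 26, 27, 28, 30} : Finset ℕ) : Set ℕ) := by
  rw [← image_wt_generatorRows]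
  ext w
  simp only [wtSet, Set.mem_ofPred_eq, SetLike.mem_coe, Finset.mem_image, Finset.mem_filter,
    Finset.mem_univ, true_and, Submodule.mem_span_range_iff_exists_fun]
  constructor
  · rintro ⟨_, ⟨v, rfl⟩, hv, rfl⟩
    refine ⟨v, ?_, rfl⟩
    rintro rfl
    simp at hv
  · rintro ⟨v, hv, rfl⟩
    refine ⟨_, ⟨v, rfl⟩, fun h => hv ?_, rfl⟩
    exact funext (Fintype.linearIndependent_iff.mp linearIndependent_generatorRows v h)

/-- There exists a `[32,3]_3` maximum weight spectrum code: a `3`-dimensional ternary linear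
code of length `32` whose weight set has cardinality `θ_3(2) = 13`. -/
theorem exists_MWS_32_3_3 :
    ∃ C : Submodule (ZMod 3) (Fin 32 → ZMod 3),
      Module.finrank (ZMod 3) C = 3 ∧
      (wtSet (C : Set (Fin 32 → ZMod 3))).ncard = 13 := by
  refine ⟨Submodule.span (ZMod 3) (Set.range generatorRows), ?_, ?_⟩
  · simpa using finrank_span_eq_card linearIndependent_generatorRows
  · rw [wtSet_span_generatorRows, Set.ncard_coe_finset]
    rfl
end

section
/- For every prime power q and every integer k ≥ 3, there exists an [n,k]_q maximum weight spectrum code with n < q^{(k^2 + k − 4)/2} = q^{k(k+1)/2 − 2}. -/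
/-- If the finite sets `S x` are pairwise distinct, there are natural multiplicities of total at
most half the number of ordered pairs of distinct indices whose sums over the `S x` are pairwise
distinct. -/
theorem exists_mul_sum_injective {X ι : Type*} [Fintype X] [Fintype ι]
    (S : X → ι → Prop) [∀ x, DecidablePred (S x)] (hS : Function.Injective S) :
    ∃ m : ι → ℕ, 2 * ∑ i, m i ≤ Fintype.card X * (Fintype.card X - 1) ∧
      ∀ x y, (∑ i, if S x i then m i else 0) = (∑ i, if S y i then m i else 0) → x = y := by
  classical
  have key : ∀ T : Finset ι, ∃ m : ι → ℕ,
      2 * ∑ i ∈ T, m i ≤ (Finset.univ.filter fun p : X × X =>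
        p.1 ≠ p.2 ∧ ∀ i ∉ T, (S p.1 i ↔ S p.2 i)).card ∧
      ∀ x y, (∀ i ∉ T, (S x i ↔ S y i)) →
        (∑ i ∈ T, if S x i then m i else 0) = (∑ i ∈ T, if S y i then m i else 0) → x = y := by
    intro T
    induction T using Finset.induction_on with
    | empty =>
      refine ⟨0, by simp, fun x y h _ => hS ?_⟩
      funext i
      exact propext (h i (by simp))
    | insert a T ha ih =>
      obtain ⟨m, hm, hinj⟩ := ih
      set N : Finset (X × X) := Finset.univ.filter fun p =>
        (∀ i ∉ insert a T, (S p.1 i ↔ S p.2 i)) ∧ S p.1 a ∧ ¬ S p.2 a with hN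
      set B : Finset ℕ := N.image fun p =>
        (∑ i ∈ T, if S p.2 i then m i else 0) - (∑ i ∈ T, if S p.1 i then m i else 0) with hB
      obtain ⟨v, hv, hvB⟩ : ∃ v ∈ Finset.range (N.card + 1), v ∉ B := by
        apply Finset.exists_mem_notMem_of_card_lt_card
        rw [Finset.card_range]
        exact Nat.lt_succ_of_le Finset.card_image_le
      have hvN : v ≤ N.card := by simpa [Nat.lt_succ_iff] using hv
      have hsum : ∀ (P : ι → Prop) [DecidablePred P], (∑ i ∈ insert a T, if P i then Function.update m a v i else 0) =
          (if P a then v else 0) + ∑ i ∈ T, if P i then m i else 0 := by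
        intro P _
        rw [Finset.sum_insert ha, Function.update_self]
        congr 1
        refine Finset.sum_congr rfl fun i hi => ?_
        rw [Function.update_of_ne (by rintro rfl; exact ha hi)]
      have hnew : ∀ x y, (∀ i ∉ insert a T, (S x i ↔ S y i)) → S x a → ¬ S y a →
          v + (∑ i ∈ T, if S x i then m i else 0) ≠ ∑ i ∈ T, if S y i then m i else 0 := by
        intro x y h hx hy he
        refine hvB (Finset.mem_image.2 ⟨(x, y), by simpa [hN, hx, hy] using h, ?_⟩)
        simp only
        omega
      refine ⟨Function.update m a v, ?_, ?_⟩
      · have h1 := hsum fun _ => True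
        simp only [if_true] at h1
        rw [h1]
        have hsub : (Finset.univ.filter fun p : X × X =>
            p.1 ≠ p.2 ∧ ∀ i ∉ T, (S p.1 i ↔ S p.2 i)) ∪ (N ∪ N.map (Equiv.prodComm X X).toEmbedding)
            ⊆ Finset.univ.filter fun p : X × X =>
              p.1 ≠ p.2 ∧ ∀ i ∉ insert a T, (S p.1 i ↔ S p.2 i) := by
          rintro ⟨x, y⟩ hp
          simp only [hN, Finset.mem_union, Finset.mem_filter, Finset.mem_univ, true_and,
            Finset.mem_map_equiv, Equiv.prodComm_symm, Equiv.prodComm_apply, Prod.swap_prod_mk]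
            at hp ⊢
          rcases hp with ⟨h, h'⟩ | ⟨h, h1, h2⟩ | ⟨h, h1, h2⟩
          · exact ⟨h, fun i hi => h' i fun h => hi (Finset.mem_insert_of_mem h)⟩
          · exact ⟨by rintro rfl; exact h2 h1, h⟩
          · exact ⟨by rintro rfl; exact h2 h1, fun i hi => (h i hi).symm⟩
        refine le_trans ?_ (Finset.card_le_card hsub)
        rw [Finset.card_union_of_disjoint, Finset.card_union_of_disjoint, Finset.card_map]
        · omega
        · rw [Finset.disjoint_left]
          rintro ⟨x, y⟩ h1 h2
          simp only [hN, Finset.mem_filter, Finset.mem_univ, true_and,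
            Finset.mem_map_equiv, Equiv.prodComm_symm, Equiv.prodComm_apply, Prod.swap_prod_mk]
            at h1 h2
          exact h1.2.2 h2.2.1
        · rw [Finset.disjoint_left]
          rintro ⟨x, y⟩ h1 h2
          simp only [hN, Finset.mem_union, Finset.mem_filter, Finset.mem_univ, true_and,
            Finset.mem_map_equiv, Equiv.prodComm_symm, Equiv.prodComm_apply, Prod.swap_prod_mk]
            at h1 h2
          have := h1.2 a ha
          tauto
      · intro x y h he
        rw [hsum, hsum] at he
        by_cases hx : S x a <;> by_cases hy : S y a
        · refine hinj x y (fun i hi => ?_) (by simpa [hx, hy] using he)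
          by_cases hia : i = a
          · subst hia; tauto
          · exact h i (by simp [hia, hi])
        · exact (hnew x y h hx hy (by simpa [hx, hy] using he)).elim
        · exact (hnew y x (fun i hi => (h i hi).symm) hy hx
            (by simpa [hx, hy] using he.symm)).elim
        · refine hinj x y (fun i hi => ?_) (by simpa [hx, hy] using he)
          by_cases hia : i = a
          · subst hia; tauto
          · exact h i (by simp [hia, hi])
  obtain ⟨m, hm, hinj⟩ := key Finset.univ
  refine ⟨m, hm.trans ?_, fun x y h => hinj x y (by simp) h⟩
  have : (Finset.univ.filter fun p : X × X =>
        p.1 ≠ p.2 ∧ ∀ i ∉ (Finset.univ : Finset ι), (S p.1 i ↔ S p.2 i)) =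
        (Finset.univ : Finset X).offDiag := by
    ext p
    simp
  rw [this, Finset.offDiag_card, Finset.card_univ, Nat.mul_sub, mul_one]

open Module in
/-- A multiset of vectors, with multiplicities `m i`, whose weights separate non-proportional
functionals yields a maximum weight spectrum code of length `∑ i, m i`. -/
theorem exists_code_of_multiplicities {F V ι : Type*} [Field F] [Fintype F] [DecidableEq F]
    [AddCommGroup V] [Module F V] [FiniteDimensional F V] [Fintype ι] (hV : 2 ≤ finrank F V)
    (P : ι → V) (m : ι → ℕ)
    (h : ∀ f g : Dual F V, f ≠ 0 → g ≠ 0 →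
      (∑ i, if f (P i) ≠ 0 then m i else 0) = (∑ i, if g (P i) ≠ 0 then m i else 0) →
      ∃ a : F, a • g = f) :
    ∃ C : Submodule F (Fin (∑ i, m i) → F),
      finrank F C = finrank F V ∧
      (wtSet (C : Set (Fin (∑ i, m i) → F))).ncard =
        (Fintype.card F ^ finrank F V - 1) / (Fintype.card F - 1) := by
  classical
  let e : (Σ i, Fin (m i)) ≃ Fin (∑ i, m i) := Fintype.equivFinOfCardEq (by simp)
  let φ : Dual F V →ₗ[F] (Fin (∑ i, m i) → F) :=
    LinearMap.pi fun j => Dual.eval F V (P (e.symm j).1)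
  have hφ : ∀ f j, φ f j = f (P (e.symm j).1) := fun _ _ => rfl
  have hwt : ∀ f, wt (φ f) = ∑ i, if f (P i) ≠ 0 then m i else 0 := by
    intro f
    rw [wt, Finset.card_filter, ← e.sum_comp, Fintype.sum_sigma]
    refine Finset.sum_congr rfl fun i _ => ?_
    simp [hφ]
  have hsmul : ∀ (a : F) (f : Dual F V), a ≠ 0 → wt (φ (a • f)) = wt (φ f) := by
    intro a f ha
    simp [wt, ha]
  have hker : ∀ f, φ f = 0 → f = 0 := by
    intro f hf
    by_contra hf0
    obtain ⟨g, hg⟩ : ∃ g, g ∉ F ∙ f := by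
      by_contra! hall
      have h1 : (⊤ : Submodule F (Dual F V)) = F ∙ f := by
        symm
        rw [eq_top_iff]
        exact fun g _ => hall g
      have h2 := finrank_span_singleton (K := F) hf0
      rw [← h1, finrank_top, Subspace.dual_finrank_eq] at h2
      omega
    have hg0 : g ≠ 0 := by
      rintro rfl
      exact hg (zero_mem _)
    have hfg0 : f + g ≠ 0 := fun h0 => hg <| by
      rw [eq_neg_of_add_eq_zero_right h0]
      exact neg_mem (Submodule.mem_span_singleton_self f)
    obtain ⟨a, ha⟩ := h (f + g) g hfg0 hg0 (by rw [← hwt, ← hwt, map_add, hf, zero_add])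
    have ha' : (a - 1) • g = f := by
      ext v
      have hv := LinearMap.congr_fun ha v
      simp only [LinearMap.smul_apply, LinearMap.add_apply, smul_eq_mul] at hv ⊢
      linear_combination hv
    have ha1 : a - 1 ≠ 0 := by
      intro h0
      rw [h0, zero_smul] at ha'
      exact hf0 ha'.symm
    refine hg (Submodule.mem_span_singleton.2 ⟨(a - 1)⁻¹, ?_⟩)
    rw [← ha', inv_smul_smul₀ ha1]
  have hφinj : Function.Injective φ := (injective_iff_map_eq_zero φ).2 hker
  refine ⟨LinearMap.range φ, ?_, ?_⟩
  · rw [LinearMap.finrank_range_of_inj hφinj, Subspace.dual_finrank_eq]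
  have hrange : wtSet (LinearMap.range φ : Set (Fin (∑ i, m i) → F)) =
      (fun p : Projectivization F (Dual F V) => wt (φ p.rep)) '' Set.univ := by
    ext w
    constructor
    · rintro ⟨_, ⟨f, rfl⟩, hf, rfl⟩
      have hf0 : f ≠ 0 := by
        rintro rfl
        exact hf (map_zero φ)
      obtain ⟨a, ha⟩ := Projectivization.exists_smul_eq_mk_rep F f hf0
      refine ⟨Projectivization.mk F f hf0, trivial, ?_⟩
      simp only
      rw [← ha]
      exact hsmul a f a.ne_zero
    · rintro ⟨p, -, rfl⟩
      exact ⟨_, ⟨p.rep, rfl⟩, fun h0 => p.rep_nonzero (hker _ h0), rfl⟩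
  have hinj : Function.Injective fun p : Projectivization F (Dual F V) => wt (φ p.rep) := by
    intro p q hpq
    simp only [hwt] at hpq
    obtain ⟨a, ha⟩ := h _ _ p.rep_nonzero q.rep_nonzero hpq
    rw [← p.mk_rep, ← q.mk_rep, Projectivization.mk_eq_mk_iff']
    exact ⟨a, ha⟩
  rw [hrange, Set.ncard_image_of_injective _ hinj, Set.ncard_univ, Projectivization.card'',
    Module.natCard_eq_pow_finrank (K := F), Subspace.dual_finrank_eq, Nat.card_eq_fintype_card]

open Module in
/-- Two nonzero functionals vanishing at the same vectors are proportional. -/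
theorem exists_smul_eq_of_ker_iff {F V : Type*} [Field F] [AddCommGroup V] [Module F V]
    (f g : Dual F V) (h : ∀ v, g v = 0 → f v = 0) : ∃ a : F, a • g = f := by
  have := mem_span_of_iInf_ker_le_ker (ι := Unit) (L := fun _ => g) (K := f)
    (by intro v hv; simpa using h v (by simpa using hv))
  rw [Set.range_const] at this
  exact Submodule.mem_span_singleton.1 this

open Module in
/-- Weights `1, 2, 4` on a basis of `𝔽₂³` separate the nonzero functionals. -/
theorem exists_smul_eq_of_sum_two_pow_eq {F : Type*} [Field F] [Fintype F] [DecidableEq F]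
    (hF : Fintype.card F = 2) (f g : Dual F (Fin 3 → F))
    (h : (∑ i : Fin 3, if f (Pi.single i 1) ≠ 0 then 2 ^ (i : ℕ) else 0) =
      ∑ i : Fin 3, if g (Pi.single i 1) ≠ 0 then 2 ^ (i : ℕ) else 0) : ∃ a : F, a • g = f := by
  have hone : ∀ x : F, x ≠ 0 → x = 1 := by
    intro x hx
    have := FiniteField.pow_card_sub_one_eq_one x hx
    simpa [hF] using this
  have heq : ∀ x y : F, (x = 0 ↔ y = 0) → x = y := by
    intro x y hxy
    by_cases hx : x = 0
    · rw [hx, hxy.1 hx]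
    · rw [hone x hx, hone y (mt hxy.2 hx)]
  refine ⟨1, ?_⟩
  rw [one_smul]
  refine (Pi.basisFun F (Fin 3)).ext fun i => ?_
  rw [Pi.basisFun_apply]
  apply heq
  have bits : ∀ b₀ b₁ b₂ c₀ c₁ c₂ : Bool,
      (if b₀ then 1 else 0) + (if b₁ then 2 else 0) + (if b₂ then 4 else 0) =
        (if c₀ then 1 else 0) + (if c₁ then 2 else 0) + (if c₂ then 4 else 0) →
      b₀ = c₀ ∧ b₁ = c₁ ∧ b₂ = c₂ := by decide
  obtain ⟨h₀, h₁, h₂⟩ := bits (f (Pi.single 0 1) ≠ 0) (f (Pi.single 1 1) ≠ 0)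
    (f (Pi.single 2 1) ≠ 0) (g (Pi.single 0 1) ≠ 0) (g (Pi.single 1 1) ≠ 0)
    (g (Pi.single 2 1) ≠ 0) (by simpa [Fin.sum_univ_three] using h)
  rw [decide_eq_decide, not_iff_not] at h₀ h₁ h₂
  fin_cases i
  exacts [h₀.symm, h₁.symm, h₂.symm]

open Module in
/-- There are multiplicities on the vectors of `V`, of total at most the number of pairs of
points of the dual projective space, separating non-proportional functionals. -/
theorem exists_multiplicities {F V : Type*} [Field F] [Fintype F] [DecidableEq F]
    [AddCommGroup V] [Module F V] [FiniteDimensional F V] [Fintype V] :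
    ∃ m : V → ℕ,
      2 * ∑ v, m v ≤ Nat.card (Projectivization F (Dual F V)) *
        (Nat.card (Projectivization F (Dual F V)) - 1) ∧
      ∀ f g : Dual F V, f ≠ 0 → g ≠ 0 →
        (∑ v, if f v ≠ 0 then m v else 0) = (∑ v, if g v ≠ 0 then m v else 0) →
        ∃ a : F, a • g = f := by
  have : Finite (Dual F V) := Module.finite_of_finite F
  have := Fintype.ofFinite (Projectivization F (Dual F V))
  have hS : Function.Injective
      fun (p : Projectivization F (Dual F V)) (v : V) => p.rep v ≠ 0 := by
    intro p q hpq
    rw [← p.mk_rep, ← q.mk_rep, Projectivization.mk_eq_mk_iff']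
    refine exists_smul_eq_of_ker_iff _ _ fun v hv => ?_
    by_contra hp
    exact (congrFun hpq v).mp hp hv
  obtain ⟨m, hm, hinj⟩ := exists_mul_sum_injective _ hS
  refine ⟨m, by rwa [Nat.card_eq_fintype_card], fun f g hf hg hfg => ?_⟩
  rw [← Projectivization.mk_eq_mk_iff' F f g hf hg]
  refine hinj _ _ ?_
  have hrep : ∀ (f : Dual F V) (hf : f ≠ 0) (v : V),
      (Projectivization.mk F f hf).rep v ≠ 0 ↔ f v ≠ 0 := by
    intro f hf v
    obtain ⟨a, ha⟩ := Projectivization.exists_smul_eq_mk_rep F f hf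
    rw [← ha, LinearMap.smul_apply, ne_eq, smul_eq_zero_iff_eq]
  simpa only [hrep] using hfg

/-- For every prime power `q` and every integer `k ≥ 3`, there exists an `[n,k]_q` maximum
weight spectrum code with `n < q^((k^2+k-4)/2) = q^(k(k+1)/2 - 2)`. -/
theorem exists_MWS_short (q k : ℕ) (hq : IsPrimePow q) (hk : 3 ≤ k)
    (F : Type*) [Field F] [Fintype F] [DecidableEq F] (hcard : Fintype.card F = q) :
    ∃ n : ℕ, n < q ^ ((k ^ 2 + k - 4) / 2) ∧
      ∃ C : Submodule F (Fin n → F),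
        Module.finrank F C = k ∧
        (wtSet (C : Set (Fin n → F))).ncard = (q ^ k - 1) / (q - 1) := by
  subst hcard
  have hq2 : 2 ≤ Fintype.card F := hq.two_le
  have hdim : Module.finrank F (Fin k → F) = k := by simp
  by_cases hsmall : Fintype.card F = 2 ∧ k = 3
  · obtain ⟨h2, rfl⟩ := hsmall
    obtain ⟨C, hC, hw⟩ := exists_code_of_multiplicities (F := F) (V := Fin 3 → F) (by simp)
      (fun i : Fin 3 => Pi.single i 1) (fun i => 2 ^ (i : ℕ))
      (fun f g _ _ h => exists_smul_eq_of_sum_two_pow_eq h2 f g h)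
    rw [hdim] at hC hw
    exact ⟨_, by simp [h2, Fin.sum_univ_three], C, hC, hw⟩
  · obtain ⟨m, hm, hsep⟩ := exists_multiplicities (F := F) (V := Fin k → F)
    obtain ⟨C, hC, hw⟩ := exists_code_of_multiplicities (by omega) (fun v : Fin k → F => v) m hsep
    rw [hdim] at hC hw
    refine ⟨_, ?_, C, hC, hw⟩
    have hdual : Module.finrank F (Module.Dual F (Fin k → F)) = k := by
      rw [Subspace.dual_finrank_eq, hdim]
    have hX := Projectivization.card_of_finrank F (Module.Dual F (Fin k → F)) hdual
    rw [Nat.card_eq_fintype_card (α := F)] at hX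
    rw [hX] at hm
    generalize Fintype.card F = q at *
    rcases hk.eq_or_lt with rfl | hk4
    · obtain ⟨r, rfl⟩ : ∃ r, q = r + 3 := ⟨q - 3, by omega⟩
      norm_num [Finset.sum_range_succ] at hm ⊢
      rw [show 1 + (r + 3) + (r + 3) ^ 2 - 1 = (r + 3) + (r + 3) ^ 2 by omega] at hm
      nlinarith [pow_nonneg (Nat.zero_le r) 3, pow_nonneg (Nat.zero_le r) 4]
    · have hlt : ∑ i ∈ Finset.range k, q ^ i < q ^ k := Nat.geomSum_lt hq2 (by simp)
      have hexp : k + k ≤ (k ^ 2 + k - 4) / 2 := by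
        rw [Nat.le_div_iff_mul_le two_pos]
        have : 4 * k ≤ k ^ 2 := by nlinarith
        have : k * 4 ≤ k ^ 2 := by nlinarith
        obtain ⟨s, rfl⟩ : ∃ s, k = s + 4 := ⟨k - 4, by omega⟩
        apply Nat.le_sub_of_add_le
        nlinarith
      refine lt_of_lt_of_le ?_ (Nat.pow_le_pow_right (by omega) hexp)
      rw [pow_add]
      have h1 := Nat.mul_le_mul hlt.le ((Nat.sub_le _ 1).trans hlt.le)
      have h2 : 0 < q ^ k * q ^ k := by positivity
      omega
end

section
/- Let C be an [n,k]_q linear code and fix i ∈ {1, …, q−1}. There exists a vector r = (r_1, …, r_{q−1}) ∈ N^{q−1} such that for all a, b ∈ C with a ≠ b one has Σ_{j=1}^{q−1} r_j (a[α^{i−j}] − b[α^{i−j}]) ≠ 0 (exponents of α taken modulo q−1), if and only if V(a) ≠ V(b) for all a, b ∈ C with a ≠ b. -/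
/-- `cnt c β` is the number of coordinates of `c` equal to `β` (denoted `c[β]`). -/
def cnt {ι F : Type*} [Fintype ι] [DecidableEq F] (c : ι → F) (β : F) : ℕ :=
  (Finset.univ.filter fun i => c i = β).card

/-- A base-`B` expansion with digits of absolute value less than `B` vanishes only if all its
digits do. -/
theorem eq_zero_of_sum_pow_mul_eq_zero {m : ℕ} {B : ℤ} (d : Fin m → ℤ)
    (hd : ∀ j, |d j| < B) (h : ∑ j : Fin m, B ^ j.val * d j = 0) (j : Fin m) : d j = 0 := by
  induction m with
  | zero => exact j.elim0
  | succ m ih =>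
    have hB : B ≠ 0 := ((abs_nonneg _).trans_lt (hd 0)).ne'
    have key : d 0 + B * ∑ j : Fin m, B ^ j.val * d j.succ = 0 := by
      rw [← h, Fin.sum_univ_succ, Finset.mul_sum]
      simp [pow_succ', mul_assoc]
    have h0 : d 0 = 0 :=
      Int.eq_zero_of_abs_lt_dvd ((dvd_add_left (dvd_mul_right B _)).1 (key ▸ dvd_zero B)) (hd 0)
    have hs : ∑ j : Fin m, B ^ j.val * d j.succ = 0 := by
      simpa [h0, hB] using key
    refine Fin.cases h0 (fun j => ?_) j
    exact ih (fun j => d j.succ) (fun j => hd j.succ) hs j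

theorem cnt_le_card {ι F : Type*} [Fintype ι] [DecidableEq F] (c : ι → F) (β : F) :
    cnt c β ≤ Fintype.card ι :=
  Finset.card_le_univ _

theorem sum_cnt {ι F : Type*} [Fintype ι] [Fintype F] [DecidableEq F] (c : ι → F) :
    ∑ β, cnt c β = Fintype.card ι :=
  (Finset.card_eq_sum_card_fiberwise fun _ _ => Finset.mem_coe.2 (Finset.mem_univ _)).symm

/-- The number of occurrences of one symbol is determined by those of all the others. -/
theorem cnt_eq_of_forall_ne {ι F : Type*} [Fintype ι] [Fintype F] [DecidableEq F]
    {a b : ι → F} {γ : F} (h : ∀ β ≠ γ, cnt a β = cnt b β) : cnt a γ = cnt b γ := by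
  have hs := (sum_cnt a).trans (sum_cnt b).symm
  rw [← Finset.add_sum_erase _ _ (Finset.mem_univ γ),
    ← Finset.add_sum_erase _ (cnt b) (Finset.mem_univ γ),
    Finset.sum_congr rfl fun β hβ => h β (Finset.ne_of_mem_erase hβ)] at hs
  exact Nat.add_right_cancel hs

/-- The powers of a primitive element, listed backwards from any exponent, exhaust the nonzero
elements of the field. -/
theorem exists_pow_sub_mod_eq {F : Type*} [Field F] [Fintype F] {α : F} {N : ℕ}
    (hcard : Fintype.card F = N + 1) (hα : orderOf α = N) (i : ℕ) {β : F} (hβ : β ≠ 0) :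
    ∃ j : Fin N, α ^ ((i + N - (j.val + 1)) % N) = β := by
  classical
  have hN : 0 < N := by
    have := Fintype.one_lt_card (α := F)
    omega
  have hα0 : α ≠ 0 := by
    rintro rfl
    have := pow_orderOf_eq_one (0 : F)
    rw [hα, zero_pow hN.ne'] at this
    exact zero_ne_one this
  let f : Fin N → Fˣ := fun j => Units.mk0 _ (pow_ne_zero ((i + N - (j.val + 1)) % N) hα0)
  have hf : Function.Injective f := by
    intro j j' hjj
    have h : α ^ ((i + N - (j.val + 1)) % N) = α ^ ((i + N - (j'.val + 1)) % N) :=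
      congrArg Units.val hjj
    have h := pow_injOn_Iio_orderOf (by simp [hα, Nat.mod_lt, hN]) (by simp [hα, Nat.mod_lt, hN]) h
    have hj := j.isLt
    have hj' := j'.isLt
    have := Nat.ModEq.eq_of_abs_lt (m := N) h (by rw [abs_lt]; omega)
    exact Fin.ext (by omega)
  have hb : Function.Bijective f :=
    (Fintype.bijective_iff_injective_and_card f).2 ⟨hf, by simp [Fintype.card_units, hcard]⟩
  obtain ⟨j, hj⟩ := hb.2 (Units.mk0 β hβ)
  exact ⟨j, congrArg Units.val hj⟩

/-- Let `C` be an `[n,k]_q` linear code, `α` a primitive element, and fix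
`i ∈ {1, …, q-1}`.  There is a vector `r = (r_1, …, r_(q-1)) ∈ ℕ^(q-1)` such that for all
distinct `a, b ∈ C` one has `∑_{j=1}^{q-1} r_j (a[α^(i-j)] - b[α^(i-j)]) ≠ 0` (exponents
mod `q-1`), if and only if `V(a) ≠ V(b)` for all distinct `a, b ∈ C`.
Here `r : Fin (q-1) → ℕ` records `r_(j+1)` at index `j`, and the exponent
`(i + (q-1) - (j+1)) % (q-1)` is `i - (j+1)` reduced modulo `q-1`. -/
theorem exists_r_separating_iff_distribution_vectors_distinct (q n k : ℕ)
    (hq : IsPrimePow q)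
    (F : Type*) [Field F] [Fintype F] [DecidableEq F] (hcard : Fintype.card F = q)
    (α : F) (hα : orderOf α = q - 1)
    (C : Submodule F (Fin n → F)) (hdim : Module.finrank F C = k)
    (i : ℕ) (hi1 : 1 ≤ i) (hi2 : i ≤ q - 1) :
    (∃ r : Fin (q - 1) → ℕ, ∀ a ∈ C, ∀ b ∈ C, a ≠ b →
        (∑ j : Fin (q - 1),
          (r j : ℤ) * ((cnt a (α ^ ((i + (q - 1) - (j.val + 1)) % (q - 1))) : ℤ)
            - (cnt b (α ^ ((i + (q - 1) - (j.val + 1)) % (q - 1))) : ℤ))) ≠ 0)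
    ↔ (∀ a ∈ C, ∀ b ∈ C, a ≠ b → ∃ β : F, cnt a β ≠ cnt b β) := by
  constructor
  · rintro ⟨r, hr⟩ a ha b hb hab
    by_contra! h
    exact hr a ha b hb hab (by simp [h])
  · intro h
    refine ⟨fun j => (n + 1) ^ j.val, fun a ha b hb hab hsum => ?_⟩
    replace hsum : ∑ j : Fin (q - 1), (n + 1 : ℤ) ^ j.val *
        ((cnt a (α ^ ((i + (q - 1) - (j.val + 1)) % (q - 1))) : ℤ)
          - (cnt b (α ^ ((i + (q - 1) - (j.val + 1)) % (q - 1))) : ℤ)) = 0 := by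
      simpa only [Nat.cast_pow, Nat.cast_add, Nat.cast_one] using hsum
    have hd := eq_zero_of_sum_pow_mul_eq_zero _ (fun j => by
      have h1 := cnt_le_card a (α ^ ((i + (q - 1) - (j.val + 1)) % (q - 1)))
      have h2 := cnt_le_card b (α ^ ((i + (q - 1) - (j.val + 1)) % (q - 1)))
      rw [Fintype.card_fin] at h1 h2
      rw [abs_lt]
      omega) hsum
    have hne : ∀ β ≠ 0, cnt a β = cnt b β := by
      intro β hβ
      obtain ⟨j, rfl⟩ := exists_pow_sub_mod_eq (by omega) hα i hβ
      exact Int.ofNat_inj.1 (sub_eq_zero.1 (hd j))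
    obtain ⟨β, hβ⟩ := h a ha b hb hab
    rcases eq_or_ne β 0 with rfl | hβ0
    · exact hβ (cnt_eq_of_forall_ne hne)
    · exact hβ (hne β hβ0)
end

section
/- Let C be an [n,k]_q linear code and let r = (r_1, …, r_{q−1}) ∈ N^{q−1} be nonzero with R = r_1 + … + r_{q−1}. Then the generalized r-repetition code C(r) is an [Rn, k]_q linear code, w(c^r) = R·w(c) for every c ∈ C, the weight sets satisfy |w(C(r))| = |w(C)|, and in particular if C is a maximum weight spectrum code then so is C(r). -/
/-- The generalized `r`-repetition vector `c^r ∈ F^(Rn)`, `R = ∑ j, r j`: the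
concatenation, for `j = 1, …, q-1`, of `r_j` copies of `α^j • c`.  A position `x` lies in
block `b = x / n` (each block has length `n`); the scalar multiplying block `b` is
`α^(j+1)` for the largest index `j : Fin (q-1)` with `∑_{j' < j} r j' ≤ b`, and this
`j + 1` equals the number of indices `j` with `∑_{j' < j} r j' ≤ b`. -/
def crep {F : Type*} [Field F] {q n : ℕ} (α : F) (r : Fin (q - 1) → ℕ) (c : Fin n → F) :
    Fin ((∑ j, r j) * n) → F := fun x =>
  α ^ (Finset.univ.filter fun j : Fin (q - 1) =>
        (∑ j' ∈ Finset.univ.filter fun j' => j' < j, r j') ≤ x.val / n).card *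
    c ⟨x.val % n,
      Nat.mod_lt _ (Nat.pos_of_ne_zero fun h => Nat.not_lt_zero x.val (by simpa [h] using x.2))⟩

/-- `c ↦ c^r` as a linear map. -/
def crepMap {F : Type*} [Field F] (q n : ℕ) (α : F) (r : Fin (q - 1) → ℕ) :
    (Fin n → F) →ₗ[F] (Fin ((∑ j, r j) * n) → F) where
  toFun c := crep α r c
  map_add' a b := by funext x; simp [crep, mul_add]
  map_smul' s a := by funext x; simp [crep, smul_eq_mul]; ring

theorem wt_crep {F : Type*} [Field F] [DecidableEq F] {q n : ℕ} {α : F} (hα : α ≠ 0)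
    (r : Fin (q - 1) → ℕ) (c : Fin n → F) :
    wt (crep α r c) = (∑ j, r j) * wt c := by
  have key : wt (crep α r c) =
      (((Finset.univ : Finset (Fin (∑ j, r j))) ×ˢ
        (Finset.univ.filter fun i => c i ≠ 0)).map finProdFinEquiv.toEmbedding).card := by
    unfold wt
    congr 1
    ext x
    rw [Finset.mem_map_equiv]
    simp only [crep, ne_eq, mul_eq_zero, pow_eq_zero_iff', hα, false_and, false_or,
      Finset.mem_filter, Finset.mem_univ, true_and, Finset.mem_product]
    rfl
  rw [key, Finset.card_map, Finset.card_product, Finset.card_fin]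
  rfl

theorem wt_eq_zero_iff {ι F : Type*} [Fintype ι] [Zero F] [DecidableEq F] {c : ι → F} :
    wt c = 0 ↔ c = 0 := by
  simp [wt, Finset.filter_eq_empty_iff, funext_iff]

theorem crep_eq_zero_iff {F : Type*} [Field F] {q n : ℕ} {α : F} (hα : α ≠ 0)
    {r : Fin (q - 1) → ℕ} (hr : ∑ j, r j ≠ 0) {c : Fin n → F} :
    crep α r c = 0 ↔ c = 0 := by
  classical
  rw [← wt_eq_zero_iff, wt_crep hα, mul_eq_zero, or_iff_right hr, wt_eq_zero_iff]

theorem crepMap_injective {F : Type*} [Field F] {q n : ℕ} {α : F} (hα : α ≠ 0)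
    {r : Fin (q - 1) → ℕ} (hr : ∑ j, r j ≠ 0) :
    Function.Injective (crepMap q n α r) :=
  (injective_iff_map_eq_zero _).2 fun _ h => (crep_eq_zero_iff hα hr).1 h

theorem wtSet_map_crepMap {F : Type*} [Field F] [DecidableEq F] {q n : ℕ} {α : F} (hα : α ≠ 0)
    {r : Fin (q - 1) → ℕ} (hr : ∑ j, r j ≠ 0) (C : Submodule F (Fin n → F)) :
    wtSet (C.map (crepMap q n α r) : Set (Fin ((∑ j, r j) * n) → F)) =
      (fun w => (∑ j, r j) * w) '' wtSet (C : Set (Fin n → F)) := by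
  ext w
  constructor
  · rintro ⟨_, ⟨c, hc, rfl⟩, hne, rfl⟩
    exact ⟨wt c, ⟨c, hc, fun h => hne ((crep_eq_zero_iff hα hr).2 h), rfl⟩, (wt_crep hα r c).symm⟩
  · rintro ⟨_, ⟨c, hc, hne, rfl⟩, rfl⟩
    exact ⟨crep α r c, ⟨c, hc, rfl⟩, fun h => hne ((crep_eq_zero_iff hα hr).1 h), wt_crep hα r c⟩

/-- Let `C` be an `[n,k]_q` linear code and `r ∈ ℕ^(q-1)` nonzero, `R = ∑ j, r j`.
Then the generalized `r`-repetition code `C(r)` is an `[Rn,k]_q` linear code (it lives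
in `F^(Rn)` and has dimension `k`), `w(c^r) = R·w(c)` for every `c ∈ C`, the weight
sets satisfy `|w(C(r))| = |w(C)|`, and in particular if `C` is a maximum weight spectrum
code then so is `C(r)`. -/
theorem crep_code_properties (q n k : ℕ) (hq : IsPrimePow q)
    (F : Type*) [Field F] [Fintype F] [DecidableEq F] (hcard : Fintype.card F = q)
    (α : F) (hα : orderOf α = q - 1)
    (C : Submodule F (Fin n → F)) (hdim : Module.finrank F C = k)
    (r : Fin (q - 1) → ℕ) (hr : r ≠ 0) :
    Module.finrank F (C.map (crepMap q n α r)) = k ∧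
    (∀ c ∈ C, wt (crep α r c) = (∑ j, r j) * wt c) ∧
    (wtSet ((C.map (crepMap q n α r) : Submodule F (Fin ((∑ j, r j) * n) → F)) :
        Set (Fin ((∑ j, r j) * n) → F))).ncard
      = (wtSet (C : Set (Fin n → F))).ncard ∧
    ((wtSet (C : Set (Fin n → F))).ncard = (q ^ k - 1) / (q - 1) →
      (wtSet ((C.map (crepMap q n α r) : Submodule F (Fin ((∑ j, r j) * n) → F)) :
          Set (Fin ((∑ j, r j) * n) → F))).ncard = (q ^ k - 1) / (q - 1)) := by
  have hα0 : α ≠ 0 := by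
    rintro rfl
    rw [orderOf_zero] at hα
    have := hq.one_lt
    omega
  have hR : ∑ j, r j ≠ 0 := fun h =>
    hr (funext fun j => Finset.sum_eq_zero_iff.1 h j (Finset.mem_univ j))
  have hcardSet : (wtSet (C.map (crepMap q n α r) : Set (Fin ((∑ j, r j) * n) → F))).ncard
      = (wtSet (C : Set (Fin n → F))).ncard := by
    rw [wtSet_map_crepMap hα0 hR,
      Set.ncard_image_of_injective _ fun _ _ h => Nat.eq_of_mul_eq_mul_left
        (Nat.pos_of_ne_zero hR) h]
  exact ⟨(C.equivMapOfInjective _ (crepMap_injective hα0 hR)).finrank_eq.symm.trans hdim,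
    fun c _ => wt_crep hα0 r c, hcardSet, fun h => hcardSet.trans h⟩
end
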